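/- Let D ∈ ℝ^{ℓ×ℓ} be a symmetric matrix with zero diagonal (D_{ii} = 0 for all i). Then there exist a dimension p and points x₁,…,x_ℓ ∈ ℝ^p with D_{ij} = ‖x_i − x_j‖² for all i, j if and only if the Gram matrix B = −(1/2)·H·D·H is positive semidefinite, where H = I_ℓ − (1/ℓ)·𝟙𝟙ᵀ is the centering matrix. -/

import Mathlib

open Matrix in
lemma centering_entry (l : ℕ) (D : Matrix (Fin l) (Fin l) ℝ) (c : ℝ) (i j : Fin l) :
    (((1 : Matrix (Fin l) (Fin l) ℝ) - c • Matrix.of (fun _ _ => (1 : ℝ))) * D *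
      ((1 : Matrix (Fin l) (Fin l) ℝ) - c • Matrix.of (fun _ _ => (1 : ℝ))) : Matrix (Fin l) (Fin l) ℝ) i j
    = D i j - c * (∑ k, D k j) - c * (∑ k, D i k) + c * c * ∑ k, ∑ m, D m k := by
  have h1 : ∀ a b, ((Matrix.of (fun _ _ => (1 : ℝ)) : Matrix (Fin l) (Fin l) ℝ) * D) a b
      = ∑ k, D k b := by intro a b; simp [Matrix.mul_apply]
  have h2 : ∀ (E : Matrix (Fin l) (Fin l) ℝ) a b,
      (E * (Matrix.of (fun _ _ => (1 : ℝ)) : Matrix (Fin l) (Fin l) ℝ)) a b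
      = ∑ k, E a k := by intro E a b; simp [Matrix.mul_apply]
  rw [sub_mul, mul_sub, one_mul, mul_one, smul_mul_assoc, mul_smul_comm]
  simp only [Matrix.sub_apply, Matrix.smul_apply, h1, h2, smul_eq_mul, Finset.sum_sub_distrib,
    ← Finset.mul_sum]
  ring

open scoped MatrixOrder in
lemma psd_factor {l : ℕ} {B : Matrix (Fin l) (Fin l) ℝ} (h : B.PosSemidef) :
    ∃ A : Matrix (Fin l) (Fin l) ℝ, B = A.conjTranspose * A :=
  CStarAlgebra.nonneg_iff_eq_star_mul_self.mp h.nonneg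

/-- A symmetric matrix `D` with zero diagonal is a squared Euclidean distance matrix
(for some dimension `p` and points `x₁, …, x_ℓ ∈ ℝ^p`) if and only if the Gram matrix
`B = -(1/2) · H · D · H` is positive semidefinite, where `H = I - (1/ℓ)·𝟙𝟙ᵀ` is the
centering matrix. -/
theorem distance_matrix_euclidean_iff_gram_posSemidef
    (l : ℕ) (hl : 0 < l) (D : Matrix (Fin l) (Fin l) ℝ)
    (hDsymm : D.IsSymm) (hDdiag : ∀ i, D i i = 0)
    (H B : Matrix (Fin l) (Fin l) ℝ)
    (hH : H = (1 : Matrix (Fin l) (Fin l) ℝ) - (l : ℝ)⁻¹ • Matrix.of (fun _ _ => (1 : ℝ)))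
    (hB : B = (-(1/2) : ℝ) • (H * D * H)) :
    (∃ (p : ℕ) (x : Fin l → EuclideanSpace ℝ (Fin p)),
        ∀ i j, D i j = ‖x i - x j‖ ^ 2) ↔ B.PosSemidef := by
  have hl' : (l : ℝ) ≠ 0 := by positivity
  constructor
  · rintro ⟨p, x, hx⟩
    have hHt : H.conjTranspose = H := by
      subst hH
      ext i j
      simp [Matrix.one_apply, eq_comm]
    let X : Matrix (Fin l) (Fin p) ℝ := Matrix.of fun i k => x i k
    let G : Matrix (Fin l) (Fin l) ℝ := X * X.conjTranspose
    have hG : ∀ i j, D i j = G i i + G j j - 2 * G i j := by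
      intro i j
      rw [hx, EuclideanSpace.real_norm_sq_eq]
      simp only [G, X, Matrix.mul_apply, Matrix.conjTranspose_apply, Matrix.of_apply, star_trivial,
        Finset.mul_sum, ← Finset.sum_add_distrib, ← Finset.sum_sub_distrib]
      refine Finset.sum_congr rfl fun k _ => ?_
      simp
      ring
    have hBG : B = H * G * H := by
      ext i j
      rw [hB, hH, Matrix.smul_apply, centering_entry, centering_entry]
      simp only [hG, Finset.sum_sub_distrib, Finset.sum_add_distrib, ← Finset.mul_sum,
        Finset.sum_const, Finset.card_univ, Fintype.card_fin, nsmul_eq_mul, smul_eq_mul]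
      field_simp
      ring
    have : B = (H * X) * (H * X).conjTranspose := by
      rw [hBG, Matrix.conjTranspose_mul, hHt]
      simp only [G, Matrix.mul_assoc]
    rw [this]
    exact Matrix.posSemidef_self_mul_conjTranspose _
  · intro h
    obtain ⟨A, hA⟩ := psd_factor h
    refine ⟨l, fun i => WithLp.toLp 2 (fun k => A k i), fun i j => ?_⟩
    have hs : ∀ a b, D a b = D b a := fun a b => hDsymm.apply b a
    have hD : D i j = B i i + B j j - 2 * B i j := by
      have e : ∀ a, ∑ k, D a k = ∑ k, D k a := fun a => Finset.sum_congr rfl fun k _ => hs _ _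
      rw [hB, hH]
      simp only [Matrix.smul_apply, centering_entry, hDdiag, e, smul_eq_mul]
      ring
    rw [hD, EuclideanSpace.real_norm_sq_eq, hA]
    simp only [Matrix.mul_apply, Matrix.conjTranspose_apply, star_trivial,
        Finset.mul_sum, ← Finset.sum_add_distrib, ← Finset.sum_sub_distrib]
    refine Finset.sum_congr rfl fun k _ => ?_
    simp
    ring
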